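/- Assume 0 < P(W = +1) < 1, P(Y = +1) > 0 and P(Y = +1, Z = +1) > 0, and let c_FN, c_FP ≥ 0 be costs of false negatives and false positives. Then for every bounded measurable loss ℓ : ℝ → ℝ and measurable g : 𝒳 → ℝ, the cost-sensitive risk satisfies c_FN · α · E_{W=+1}[ℓ(g(X))] + c_FP · (1 − α) · E_{W=−1}[ℓ(−g(X))] = c_FN · ( β · E_{Y=+1}[ℓ(g(X))] − γ · E_{(Y,Z)=(+1,+1)}[ℓ(g(X))] ) + c_FP · ( E[ℓ(−g(X))] − β · E_{Y=+1}[ℓ(−g(X))] + γ · E_{(Y,Z)=(+1,+1)}[ℓ(−g(X))] ), where E[·] is the unconditional expectation. -/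

import Mathlib

open MeasureTheory ProbabilityTheory

/-- The integral over an event is its probability times the conditional expectation. -/
theorem measure_toReal_mul_integral_cond {Ω : Type*} [MeasurableSpace Ω]
    (P : Measure Ω) [IsFiniteMeasure P] (s : Set Ω) (f : Ω → ℝ) :
    (P s).toReal * ∫ ω, f ω ∂(P[|s]) = ∫ ω in s, f ω ∂P := by
  rw [ProbabilityTheory.cond, integral_smul_measure, ENNReal.toReal_inv, smul_eq_mul]
  rcases eq_or_ne (P s) 0 with h | h
  · simp [h, Measure.restrict_eq_zero.mpr h]
  · rw [mul_inv_cancel_left₀ (ENNReal.toReal_ne_zero.mpr ⟨h, measure_ne_top P s⟩)]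

/-- cost-sensitive double PU risk identity. Assume `0 < P(W = +1) < 1`,
`P(Y = +1) > 0`, `P(Y = +1, Z = +1) > 0`, and `c_FN, c_FP ≥ 0`. Then for every bounded
measurable loss `ℓ` and measurable `g`,
`c_FN·α·E_{W=+1}[ℓ(g(X))] + c_FP·(1−α)·E_{W=−1}[ℓ(−g(X))]
  = c_FN·(β·E_{Y=+1}[ℓ(g(X))] − γ·E_{(Y,Z)=(+1,+1)}[ℓ(g(X))])
    + c_FP·(E[ℓ(−g(X))] − β·E_{Y=+1}[ℓ(−g(X))] + γ·E_{(Y,Z)=(+1,+1)}[ℓ(−g(X))])`. -/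
theorem double_pu_cost_sensitive_risk_identity
    {Ω 𝓧 : Type*} [MeasurableSpace Ω] [MeasurableSpace 𝓧]
    (P : Measure Ω) [IsProbabilityMeasure P]
    (X : Ω → 𝓧) (Y Z W : Ω → ℤ)
    (hX : Measurable X) (hY : Measurable Y) (hZ : Measurable Z)
    (hYval : ∀ ω, Y ω = 1 ∨ Y ω = -1) (hZval : ∀ ω, Z ω = 1 ∨ Z ω = -1)
    (hW : ∀ ω, W ω = if Y ω = 1 ∧ Z ω = -1 then 1 else -1)
    (hα0 : 0 < P {ω | W ω = 1}) (hα1 : P {ω | W ω = 1} < 1)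
    (hβ : 0 < P {ω | Y ω = 1})
    (hγ : 0 < P ({ω | Y ω = 1} ∩ {ω | Z ω = 1}))
    (cFN cFP : ℝ) (hcFN : 0 ≤ cFN) (hcFP : 0 ≤ cFP)
    (ℓ : ℝ → ℝ) (hℓ : Measurable ℓ) (C : ℝ) (hbd : ∀ z, |ℓ z| ≤ C)
    (g : 𝓧 → ℝ) (hg : Measurable g) :
    cFN * ((P {ω | W ω = 1}).toReal * ∫ ω, ℓ (g (X ω)) ∂(P[|{ω | W ω = 1}]))
      + cFP * ((1 - (P {ω | W ω = 1}).toReal)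
          * ∫ ω, ℓ (-(g (X ω))) ∂(P[|{ω | W ω = -1}]))
    = cFN * ((P {ω | Y ω = 1}).toReal * ∫ ω, ℓ (g (X ω)) ∂(P[|{ω | Y ω = 1}])
          - (P ({ω | Y ω = 1} ∩ {ω | Z ω = 1})).toReal
              * ∫ ω, ℓ (g (X ω)) ∂(P[|({ω | Y ω = 1} ∩ {ω | Z ω = 1})]))
      + cFP * ((∫ ω, ℓ (-(g (X ω))) ∂P)
          - (P {ω | Y ω = 1}).toReal * ∫ ω, ℓ (-(g (X ω))) ∂(P[|{ω | Y ω = 1}])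
          + (P ({ω | Y ω = 1} ∩ {ω | Z ω = 1})).toReal
              * ∫ ω, ℓ (-(g (X ω))) ∂(P[|({ω | Y ω = 1} ∩ {ω | Z ω = 1})])) := by
  have hmeas {V : Ω → ℤ} (hV : Measurable V) (k : ℤ) : MeasurableSet {ω | V ω = k} :=
    hV (measurableSet_singleton k)
  have hW_one : {ω | W ω = 1} = {ω | Y ω = 1} \ {ω | Z ω = 1} := by
    ext ω
    have := hW ω
    have := hZval ω
    simp only [Set.mem_ofPred_eq, Set.mem_sdiff]
    grind
  have hW_neg : {ω | W ω = -1} = {ω | W ω = 1}ᶜ := by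
    ext ω
    have := hW ω
    simp only [Set.mem_ofPred_eq, Set.mem_compl_iff]
    grind
  have hW_meas : MeasurableSet {ω | W ω = 1} := by
    rw [hW_one]
    exact (hmeas hY 1).diff (hmeas hZ 1)
  have hcompl : 1 - (P {ω | W ω = 1}).toReal = (P {ω | W ω = -1}).toReal := by
    rw [hW_neg]
    exact (probReal_compl_eq_one_sub hW_meas).symm
  have hint {h : 𝓧 → ℝ} (hh : Measurable h) : Integrable (fun ω => ℓ (h (X ω))) P :=
    .of_bound (hℓ.comp (hh.comp hX)).aestronglyMeasurable C (.of_forall fun ω => hbd _)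
  have hsplit {f : Ω → ℝ} (hf : Integrable f P) :
      ∫ ω in {ω | Y ω = 1} ∩ {ω | Z ω = 1}, f ω ∂P + ∫ ω in {ω | W ω = 1}, f ω ∂P
        = ∫ ω in {ω | Y ω = 1}, f ω ∂P := by
    rw [hW_one]
    exact integral_inter_add_sdiff (hmeas hZ 1) hf.integrableOn
  have hpos := hsplit (hint hg)
  have hneg := hsplit (hint hg.neg)
  have htotal := integral_add_compl hW_meas (hint hg.neg)
  rw [← hW_neg] at htotal
  simp only [Pi.neg_apply] at hneg htotal
  simp only [hcompl, measure_toReal_mul_integral_cond]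
  rw [← hpos, ← hneg, ← htotal]
  ring
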